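/- Let b, c, K, s₁, s₂, s₃ be complex constants with c ≠ 0, and let u be a transcendental (non-rational) meromorphic solution of (E). Then u is periodic: there exists p ∈ ℂ, p ≠ 0, such that u(z + p) = u(z) for all z ∈ ℂ. -/

import Mathlib

open Complex Filter Topology
noncomputable section

/-- `u` has a pole at `z₀`: `‖u z‖ → ∞` as `z → z₀`, `z ≠ z₀`. -/
def IsPoleAt (u : ℂ → ℂ) (z₀ : ℂ) : Prop :=
  Tendsto (fun z => ‖u z‖) (𝓝[≠] z₀) atTop

/-- `u` is meromorphic on all of `ℂ`: at every point it is either analytic or has a pole. -/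
def MeromorphicOnPlane (u : ℂ → ℂ) : Prop :=
  ∀ z : ℂ, AnalyticAt ℂ u z ∨ IsPoleAt u z

/-- Equation (E) at the point `z`. -/
def SatisfiesE (b c K s₁ s₂ s₃ : ℂ) (u : ℂ → ℂ) (z : ℂ) : Prop :=
  deriv u z * iteratedDeriv 3 u z - (1/2) * (iteratedDeriv 2 u z)^2
    + 30 * b * (deriv u z)^2
    - (30 / c^2) * ((u z)^4 - 4*s₁*(u z)^3 + 6*s₂*(u z)^2 - 4*s₃*(u z)
        + 3*s₁^4 - 6*s₁^2*s₂ + 4*s₁*s₃) = K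

/-- A meromorphic solution of (E). -/
def IsMeromorphicSolution (b c K s₁ s₂ s₃ : ℂ) (u : ℂ → ℂ) : Prop :=
  MeromorphicOnPlane u ∧ ∀ z : ℂ, AnalyticAt ℂ u z → SatisfiesE b c K s₁ s₂ s₃ u z

/-- `u` is a rational function of `z`. -/
def IsRationalFunction (u : ℂ → ℂ) : Prop :=
  ∃ p q : Polynomial ℂ, q ≠ 0 ∧
    ∀ z : ℂ, AnalyticAt ℂ u z → Polynomial.eval z q ≠ 0 →
      u z = Polynomial.eval z p / Polynomial.eval z q


/-- Near `x` (and off `x`) the function `F` is `(z - x) ^ k` times an analytic function with value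
`a` at `x`; the value `a = 0` is allowed. -/
def HasLead (F : ℂ → ℂ) (x : ℂ) (k : ℤ) (a : ℂ) : Prop :=
  ∃ f : ℂ → ℂ, AnalyticAt ℂ f x ∧ f x = a ∧ ∀ᶠ z in 𝓝[≠] x, F z = (z - x) ^ k * f z

namespace HasLead

variable {F G : ℂ → ℂ} {x a d : ℂ} {k l : ℤ}

lemma congr (h : HasLead F x k a) (hFG : ∀ᶠ z in 𝓝[≠] x, G z = F z) : HasLead G x k a := by
  obtain ⟨f, hf, ha, hF⟩ := h
  refine ⟨f, hf, ha, ?_⟩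
  filter_upwards [hF, hFG] with z h1 h2
  rw [h2, h1]

lemma cast (h : HasLead F x k a) (hk : k = l) (ha : a = d) : HasLead F x l d := by
  subst hk ha; exact h

lemma add (hF : HasLead F x k a) (hG : HasLead G x k d) :
    HasLead (fun z => F z + G z) x k (a + d) := by
  obtain ⟨f, hf, rfl, hF⟩ := hF
  obtain ⟨g, hg, rfl, hG⟩ := hG
  refine ⟨fun z => f z + g z, hf.add hg, rfl, ?_⟩
  filter_upwards [hF, hG] with z h1 h2
  rw [h1, h2]; ring

lemma const_mul (e : ℂ) (hF : HasLead F x k a) : HasLead (fun z => e * F z) x k (e * a) := by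
  obtain ⟨f, hf, rfl, hF⟩ := hF
  refine ⟨fun z => e * f z, analyticAt_const.mul hf, rfl, ?_⟩
  filter_upwards [hF] with z h1
  rw [h1]; ring

lemma mul (hF : HasLead F x k a) (hG : HasLead G x l d) :
    HasLead (fun z => F z * G z) x (k + l) (a * d) := by
  obtain ⟨f, hf, rfl, hF⟩ := hF
  obtain ⟨g, hg, rfl, hG⟩ := hG
  refine ⟨fun z => f z * g z, hf.mul hg, rfl, ?_⟩
  filter_upwards [hF, hG, self_mem_nhdsWithin] with z h1 h2 hz
  rw [h1, h2, zpow_add₀ (sub_ne_zero.2 hz)]; ring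

lemma const (e : ℂ) : HasLead (fun _ => e) x 0 e :=
  ⟨fun _ => e, analyticAt_const, rfl, by simp⟩

lemma of_lt (hF : HasLead F x k a) (hl : l < k) : HasLead F x l 0 := by
  obtain ⟨f, hf, rfl, hF⟩ := hF
  obtain ⟨n, hn⟩ := Int.eq_ofNat_of_zero_le (sub_nonneg.2 hl.le)
  have hn0 : n ≠ 0 := by omega
  refine ⟨fun z => (z - x) ^ n * f z, by fun_prop, by simp [hn0], ?_⟩
  filter_upwards [hF, self_mem_nhdsWithin] with z h1 hz
  rw [h1, show k = l + n by omega, zpow_add₀ (sub_ne_zero.2 hz), zpow_natCast]; ring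

lemma deriv (hF : HasLead F x k a) : HasLead (deriv F) x (k - 1) (k * a) := by
  obtain ⟨f, hf, rfl, hF⟩ := hF
  refine ⟨fun z => k * f z + (z - x) * _root_.deriv f z, ?_, by simp, ?_⟩
  · have := hf.deriv
    fun_prop
  · have h1 : ∀ᶠ z in 𝓝[≠] x, F =ᶠ[𝓝 z] fun z => (z - x) ^ k * f z :=
      (eventually_eventually_nhdsWithin (s := {x}ᶜ)).2 hF |>.and self_mem_nhdsWithin |>.mono
        fun z hz => by rw [EventuallyEq, ← isOpen_compl_singleton.nhdsWithin_eq hz.2]; exact hz.1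
    have h2 : ∀ᶠ z in 𝓝[≠] x, AnalyticAt ℂ f z :=
      hf.eventually_analyticAt.filter_mono nhdsWithin_le_nhds
    filter_upwards [h1, h2, self_mem_nhdsWithin] with z e1 e2 hz
    have hz : z - x ≠ 0 := sub_ne_zero.2 hz
    rw [e1.deriv_eq]
    have e3 : HasDerivAt (fun z => (z - x) ^ k) (k * (z - x) ^ (k - 1)) z :=
      (hasDerivAt_zpow k (z - x) (Or.inl hz)).comp_sub_const z x
    rw [(e3.fun_mul e2.differentiableAt.hasDerivAt).deriv]
    have e4 : (z - x) ^ k = (z - x) ^ (k - 1) * (z - x) := by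
      rw [← zpow_add_one₀ hz, sub_add_cancel]
    rw [e4]; ring

lemma eq_zero (hF : HasLead F x k a) (h0 : ∀ᶠ z in 𝓝[≠] x, F z = 0) : a = 0 := by
  obtain ⟨f, hf, rfl, hF⟩ := hF
  have h1 : ∀ᶠ z in 𝓝[≠] x, f z = 0 := by
    filter_upwards [hF, h0, self_mem_nhdsWithin] with z h1 h2 hz
    have hz : z - x ≠ 0 := sub_ne_zero.2 hz
    rw [h2] at h1
    simpa [zpow_ne_zero k hz] using h1.symm
  exact tendsto_nhds_unique (hf.continuousAt.tendsto.mono_left nhdsWithin_le_nhds)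
    ((tendsto_congr' h1).2 tendsto_const_nhds)

lemma meromorphicAt (hF : HasLead F x k a) : MeromorphicAt F x := by
  obtain ⟨f, hf, -, hF⟩ := hF
  have : MeromorphicAt (fun z => (z - x) ^ k * f z) x :=
    (((analyticAt_id.sub analyticAt_const).meromorphicAt).zpow k).mul hf.meromorphicAt
  exact this.congr (hF.mono fun z hz => hz.symm)

/-- Translating the argument. -/
lemma comp_add_const {y p : ℂ} (hF : HasLead F (y + p) k a) :
    HasLead (fun z => F (z + p)) y k a := by
  obtain ⟨f, hf, ha, hF⟩ := hF
  refine ⟨fun z => f (z + p), ?_, ha, ?_⟩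
  · exact hf.comp_of_eq (by fun_prop) rfl
  · have ht : Tendsto (fun z => z + p) (𝓝[≠] y) (𝓝[≠] (y + p)) := by
      refine tendsto_nhdsWithin_of_tendsto_nhds_of_eventually_within _ ?_ ?_
      · exact (Continuous.tendsto (by fun_prop) y).mono_left nhdsWithin_le_nhds
      · filter_upwards [self_mem_nhdsWithin] with z hz
        simpa using hz
    filter_upwards [ht.eventually hF] with z hz
    rw [hz]; congr 2; ring

end HasLead

lemma MeromorphicAt.exists_hasLead {F : ℂ → ℂ} {x : ℂ} (hF : MeromorphicAt F x) :
    (∀ᶠ z in 𝓝[≠] x, F z = 0) ∨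
      ∃ (k : ℤ) (a : ℂ), a ≠ 0 ∧ meromorphicOrderAt F x = k ∧ HasLead F x k a := by
  by_cases h : meromorphicOrderAt F x = ⊤
  · exact Or.inl (meromorphicOrderAt_eq_top_iff.1 h)
  · obtain ⟨k, hk⟩ := WithTop.ne_top_iff_exists.1 h
    obtain ⟨f, hf, h0, he⟩ := (meromorphicOrderAt_eq_int_iff hF).1 hk.symm
    exact Or.inr ⟨k, f x, h0, hk.symm, f, hf, rfl, by simpa using he⟩

/-- A nonzero difference of two functions with the same leading term has a higher leading order. -/
lemma HasLead.exists_sub {F G : ℂ → ℂ} {x a : ℂ} {k : ℤ} (hF : HasLead F x k a)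
    (hG : HasLead G x k a) :
    (∀ᶠ z in 𝓝[≠] x, F z = G z) ∨
      ∃ (n : ℤ) (β : ℂ), k < n ∧ β ≠ 0 ∧ HasLead (fun z => F z - G z) x n β := by
  have hsub : HasLead (fun z => F z - G z) x k 0 := by
    refine ((hF.add (hG.const_mul (-1))).cast rfl (by ring)).congr (.of_forall fun z => by ring)
  rcases hsub.meromorphicAt.exists_hasLead with h | ⟨n, β, hβ, -, hn⟩
  · exact Or.inl (h.mono fun z hz => sub_eq_zero.1 hz)
  · refine Or.inr ⟨n, β, ?_, hβ, hn⟩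
    by_contra! hk
    have hn' : HasLead (fun z => F z - G z) x n 0 := by
      rcases hk.lt_or_eq with h | rfl
      exacts [hsub.of_lt h, hsub]
    have := (hn'.add (hn.const_mul (-1))).eq_zero (.of_forall fun z => by ring)
    simp [hβ] at this

lemma SatisfiesE.deriv_form {b c K s₁ s₂ s₃ : ℂ} {u : ℂ → ℂ} {z : ℂ}
    (h : SatisfiesE b c K s₁ s₂ s₃ u z) :
    deriv u z * deriv (deriv (deriv u)) z - (1/2) * (deriv (deriv u) z)^2
    + 30 * b * (deriv u z)^2
    - (30 / c^2) * ((u z)^4 - 4*s₁*(u z)^3 + 6*s₂*(u z)^2 - 4*s₃*(u z)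
        + 3*s₁^4 - 6*s₁^2*s₂ + 4*s₁*s₃) = K := by
  simpa only [SatisfiesE, iteratedDeriv_succ, iteratedDeriv_zero] using h

/-- Dominant balance: a pole of a solution is double, with leading coefficient `±c`. -/
lemma pole_of_satisfiesE {b c K s₁ s₂ s₃ : ℂ} {u : ℂ → ℂ} {x a : ℂ} {k : ℤ}
    (hc : c ≠ 0) (h : HasLead u x k a) (ha : a ≠ 0) (hk : k < 0)
    (hE : ∀ᶠ z in 𝓝[≠] x, SatisfiesE b c K s₁ s₂ s₃ u z) : k = -2 ∧ a ^ 2 = c ^ 2 := by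
  have h1 := h.deriv
  have h2 := h1.deriv
  have h3 := h2.deriv
  have hA := ((h1.mul h3).add ((h2.mul h2).const_mul (-(1/2))|>.cast (by ring) rfl)).cast
    (show _ = 2 * k - 4 by ring) rfl
  have hB := ((h1.mul h1).const_mul (30 * b)).cast (show _ = 2 * k - 2 by ring) rfl
  have hQ := ((h.mul h).mul (h.mul h)).cast (show _ = 4 * k by ring) rfl
  have hQ3 := ((((h.mul h).mul h).const_mul (-4 * s₁)).cast (show _ = 3 * k by ring) rfl).of_lt
    (show 4 * k < 3 * k by linarith)
  have hQ2 := (((h.mul h).const_mul (6 * s₂)).cast (show _ = 2 * k by ring) rfl).of_lt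
    (show 4 * k < 2 * k by linarith)
  have hQ1 := (h.const_mul (-4 * s₃)).of_lt (show 4 * k < k by linarith)
  have hQ0 := (HasLead.const (x := x) (3*s₁^4 - 6*s₁^2*s₂ + 4*s₁*s₃ + K / (30 / c^2))).of_lt
    (show 4 * k < 0 by linarith)
  have hR := ((((hQ.add hQ3).add hQ2).add hQ1).add hQ0).const_mul (-(30 / c^2))
  have hc2 : 30 / c ^ 2 ≠ 0 := div_ne_zero (by norm_num) (pow_ne_zero 2 hc)
  have key : ∀ᶠ z in 𝓝[≠] x, _ := hE.mono fun z hz => by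
    have := hz.deriv_form
    exact show deriv u z * deriv (deriv (deriv u)) z +
        -(1/2) * (deriv (deriv u) z * deriv (deriv u) z) + 30 * b * (deriv u z * deriv u z)
        + -(30 / c^2) * (u z * u z * (u z * u z) + -4 * s₁ * (u z * u z * u z)
          + 6 * s₂ * (u z * u z) + -4 * s₃ * u z
          + (3*s₁^4 - 6*s₁^2*s₂ + 4*s₁*s₃ + K / (30 / c^2))) = 0 by
      have hK : (30 / c ^ 2) * (K / (30 / c ^ 2)) = K := mul_div_cancel₀ _ hc2
      linear_combination this - hK
  rcases lt_trichotomy k (-2) with hlt | rfl | hgt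
  · have := (((hA.of_lt (show 4 * k < _ by linarith)).add
      (hB.of_lt (show 4 * k < _ by linarith))).add hR).eq_zero key
    simp [ha, hc] at this
  · have := ((hA.add (hB.of_lt (show _ < _ by norm_num))).add
      (hR.cast (by norm_num) rfl)).eq_zero key
    refine ⟨rfl, ?_⟩
    have h4 : 30 * a ^ 2 * (c ^ 2 - a ^ 2) = 0 := by
      field_simp at this
      push_cast at this
      linear_combination (1/2) * this
    have : c ^ 2 - a ^ 2 = 0 := by simpa [ha] using h4
    linear_combination -this
  · obtain rfl : k = -1 := by omega
    have := ((hA.add (hB.of_lt (show _ < _ by norm_num))).add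
      (hR.of_lt (show _ < _ by norm_num))).eq_zero key
    have h4 : 4 * a ^ 2 = 0 := by
      push_cast at this
      linear_combination this
    simp [ha] at h4

/-- Two solutions having a double pole with the same leading coefficient at a point agree near it:
the resonance polynomial `s³ + 11 s + 60` has no integer root larger than `-2`. -/
lemma eventuallyEq_of_satisfiesE {b c K s₁ s₂ s₃ : ℂ} {u v : ℂ → ℂ} {x a : ℂ}
    (hc : c ≠ 0) (ha : a ≠ 0) (hac : a ^ 2 = c ^ 2) (hu : HasLead u x (-2) a)
    (hv : HasLead v x (-2) a)
    (hua : ∀ᶠ z in 𝓝[≠] x, AnalyticAt ℂ u z) (hva : ∀ᶠ z in 𝓝[≠] x, AnalyticAt ℂ v z)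
    (hEu : ∀ᶠ z in 𝓝[≠] x, SatisfiesE b c K s₁ s₂ s₃ u z)
    (hEv : ∀ᶠ z in 𝓝[≠] x, SatisfiesE b c K s₁ s₂ s₃ v z) :
    ∀ᶠ z in 𝓝[≠] x, u z = v z := by
  rcases hu.exists_sub hv with h | ⟨n, β, hn, hβ, hw⟩
  · exact h
  exfalso
  have u1 := hu.deriv
  have u2 := u1.deriv
  have u3 := u2.deriv
  have v1 := hv.deriv
  have v2 := v1.deriv
  have v3 := v2.deriv
  have w1 := hw.deriv
  have w2 := w1.deriv
  have w3 := w2.deriv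
  have t1 := (w1.mul u3).cast (show _ = n - 6 by ring) rfl
  have t2 := (v1.mul w3).cast (show _ = n - 6 by ring) rfl
  have t3 := (((u2.add v2).mul w2).const_mul (-(1/2))).cast (show _ = n - 6 by ring) rfl
  have t4 := (((u1.add v1).mul w1).const_mul (30 * b)).of_lt (show n - 6 < _ by linarith)
  have uu := hu.mul hu
  have vv := hv.mul hv
  have uv := hu.mul hv
  have q3 := ((((uu.mul hu).add (uu.mul hv)).add (hu.mul vv)).add (hv.mul vv))
  have q2 := ((((uu.add uv).add vv).const_mul (-4 * s₁))).of_lt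
    (show -2 + -2 + -2 < _ by norm_num)
  have q1 := ((hu.add hv).const_mul (6 * s₂)).of_lt (show -2 + -2 + -2 < _ by norm_num)
  have q0 := (HasLead.const (x := x) (-4 * s₃)).of_lt (show -2 + -2 + -2 < _ by norm_num)
  have t5 := ((hw.mul (((q3.add q2).add q1).add q0)).const_mul (-(30 / c ^ 2))).cast
    (show _ = n - 6 by ring) rfl
  have key := ((((t1.add t2).add t3).add t4).add t5).eq_zero (by
    filter_upwards [hua, hva, hEu, hEv] with z au av eu ev
    have d1 : deriv (fun z => u z - v z) =ᶠ[𝓝 z] fun z => deriv u z - deriv v z := by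
      filter_upwards [au.eventually_analyticAt, av.eventually_analyticAt] with y h1 h2
      exact deriv_fun_sub h1.differentiableAt h2.differentiableAt
    have d2 : deriv (deriv (fun z => u z - v z)) =ᶠ[𝓝 z]
        fun z => deriv (deriv u) z - deriv (deriv v) z := by
      filter_upwards [d1.eventuallyEq_nhds, au.eventually_analyticAt, av.eventually_analyticAt]
        with y h0 h1 h2
      rw [h0.deriv_eq]
      exact deriv_fun_sub h1.deriv.differentiableAt h2.deriv.differentiableAt
    have d3 : deriv (deriv (deriv (fun z => u z - v z))) z =
        deriv (deriv (deriv u)) z - deriv (deriv (deriv v)) z := by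
      rw [d2.deriv_eq]
      exact deriv_fun_sub au.deriv.deriv.differentiableAt av.deriv.deriv.differentiableAt
    rw [d1.eq_of_nhds, d2.eq_of_nhds, d3]
    linear_combination eu.deriv_form - ev.deriv_form)
  have hfac : (-2 * a * β) * ((n : ℂ) ^ 3 + 11 * n + 60) = 0 := by
    have hc2 : (30 / c ^ 2) * a ^ 2 = 30 := by rw [hac]; field_simp
    push_cast at key
    linear_combination key + 4 * a * β * hc2
  have hint : n ^ 3 + 11 * n + 60 = 0 := by
    have : (n : ℂ) ^ 3 + 11 * n + 60 = 0 := by simpa [ha, hβ] using hfac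
    exact_mod_cast this
  have hn' : -1 ≤ n := by omega
  nlinarith [sq_nonneg (n - 1), sq_nonneg n, mul_nonneg (show 0 ≤ n + 1 by omega) (sq_nonneg n)]

/-- A function each of whose points is analytic or a pole has only countably many poles. -/
lemma MeromorphicOnPlane.countable_poles {u : ℂ → ℂ} (hu : MeromorphicOnPlane u) :
    {z | ¬ AnalyticAt ℂ u z}.Countable := by
  have hS (n : ℕ) : {z | ¬ AnalyticAt ℂ u z ∧ ‖u z‖ ≤ n}.Countable := by
    have hd : DiscreteTopology {z | ¬ AnalyticAt ℂ u z ∧ ‖u z‖ ≤ n} := by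
      rw [discreteTopology_subtype_iff]
      intro x hx
      have h1 : ∀ᶠ z in 𝓝[≠] x, (n : ℝ) < ‖u z‖ :=
        ((hu x).resolve_left hx.1).eventually_gt_atTop _
      rw [← _root_.disjoint_iff]
      refine Filter.disjoint_principal_right.2 (h1.mono fun z hz h => ?_)
      exact absurd h.2 (not_le.2 hz)
    exact Set.countable_coe_iff.1 countable_of_Lindelof_of_discrete
  refine (Set.countable_iUnion hS).mono fun z hz => ?_
  obtain ⟨n, hn⟩ := exists_nat_ge ‖u z‖
  exact Set.mem_iUnion.2 ⟨n, hz, hn⟩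

/-- Poles are isolated, so `u` is meromorphic in the usual sense. -/
lemma MeromorphicOnPlane.meromorphicAt {u : ℂ → ℂ} (hu : MeromorphicOnPlane u) (x : ℂ) :
    MeromorphicAt u x := by
  classical
  by_cases hx : AnalyticAt ℂ u x
  · exact hx.meromorphicAt
  set g : ℂ → ℂ := fun z => if AnalyticAt ℂ u z then (u z)⁻¹ else 0 with hg
  have hpole {z : ℂ} (hz : ¬ AnalyticAt ℂ u z) : ContinuousAt g z := by
    rw [continuousAt_iff_punctured_nhds]
    have h0 : g z = 0 := by simp [hg, hz]
    rw [h0]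
    refine squeeze_zero_norm (fun y => ?_) ((hu z).resolve_left hz).inv_tendsto_atTop
    by_cases hy : AnalyticAt ℂ u y <;> simp [hg, hy]
  have han {z : ℂ} (hz : AnalyticAt ℂ u z) (h0 : u z ≠ 0) : AnalyticAt ℂ g z :=
    (hz.inv h0).congr (hz.eventually_analyticAt.mono fun y hy => by simp [hg, hy])
  have hlarge : ∀ᶠ z in 𝓝[≠] x, 1 < ‖u z‖ := ((hu x).resolve_left hx).eventually_gt_atTop _
  have hne : ∀ᶠ z in 𝓝[≠] x, u z ≠ 0 :=
    hlarge.mono fun z hz => norm_pos_iff.1 (one_pos.trans hz)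
  obtain ⟨r, hr, hball⟩ := Metric.eventually_nhds_iff_ball.1 (eventually_nhdsWithin_iff.1 hne)
  have hux {z : ℂ} (hz : z ∈ Metric.ball x r) (ha : AnalyticAt ℂ u z) : u z ≠ 0 :=
    hball z hz (by rintro rfl; exact hx ha)
  have hgx : AnalyticAt ℂ g x := by
    have := hasFPowerSeriesOnBall_of_differentiable_off_countable (R := ⟨r / 2, by positivity⟩)
      (c := x) (f := g) hu.countable_poles (fun z hz => ?_) (fun z hz => ?_) (half_pos hr)
    · exact this.analyticAt
    · have hz : z ∈ Metric.ball x r := Metric.closedBall_subset_ball (half_lt_self hr) hz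
      by_cases ha : AnalyticAt ℂ u z
      · exact (han ha (hux hz ha)).continuousAt.continuousWithinAt
      · exact (hpole ha).continuousWithinAt
    · have ha : AnalyticAt ℂ u z := by simpa using hz.2
      have hz : z ∈ Metric.ball x r := Metric.ball_subset_ball (half_le_self hr.le) hz.1
      exact (han ha (hux hz ha)).differentiableAt
  have hg0 : ∀ᶠ z in 𝓝[≠] x, g z ≠ 0 := by
    refine hgx.eventually_eq_zero_or_eventually_ne_zero.resolve_left fun h => ?_
    have hmem : {z | ¬ AnalyticAt ℂ u z} ∈ 𝓝 x := by
      filter_upwards [h, Metric.ball_mem_nhds x hr] with z hz hzr ha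
      exact hux hzr ha (by simpa [hg, ha] using hz)
    obtain ⟨z, hz1, hz2⟩ := (hu.countable_poles.dense_compl ℝ).inter_nhds_nonempty hmem
    exact hz1 hz2
  refine hgx.meromorphicAt.inv.congr (hg0.mono fun z hz => ?_)
  by_cases ha : AnalyticAt ℂ u z
  · simp [hg, ha]
  · simp [hg, ha] at hz

lemma IsPoleAt.exists_hasLead {b c K s₁ s₂ s₃ : ℂ} {u : ℂ → ℂ} (hc : c ≠ 0)
    (hu : IsMeromorphicSolution b c K s₁ s₂ s₃ u) {x : ℂ} (hx : IsPoleAt u x) :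
    ∃ a : ℂ, a ^ 2 = c ^ 2 ∧ HasLead u x (-2) a := by
  have hm := hu.1.meromorphicAt x
  have ho : meromorphicOrderAt u x < 0 :=
    (tendsto_cobounded_iff_meromorphicOrderAt_neg hm).1 (tendsto_norm_atTop_iff_cobounded.1 hx)
  rcases hm.exists_hasLead with h | ⟨k, a, ha, hk, hl⟩
  · rw [meromorphicOrderAt_eq_top_iff.2 h] at ho
    exact absurd ho (by simp)
  · rw [hk] at ho
    obtain ⟨rfl, h2⟩ := pole_of_satisfiesE hc hl ha (by exact_mod_cast ho)
      (hm.eventually_analyticAt.mono hu.2)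
    exact ⟨a, h2, hl⟩

lemma SatisfiesE.comp_add_const {b c K s₁ s₂ s₃ p : ℂ} {u : ℂ → ℂ} {z : ℂ}
    (h : SatisfiesE b c K s₁ s₂ s₃ u (z + p)) :
    SatisfiesE b c K s₁ s₂ s₃ (fun z => u (z + p)) z := by
  have e (f : ℂ → ℂ) : deriv (fun z => f (z + p)) = fun z => deriv f (z + p) :=
    funext fun z => deriv_comp_add_const f p z
  simpa only [SatisfiesE, iteratedDeriv_succ, iteratedDeriv_zero, e] using h

/-- Two distinct poles with the same leading coefficient force periodicity. -/
lemma periodic_of_hasLead {b c K s₁ s₂ s₃ a x y : ℂ} {u : ℂ → ℂ} (hc : c ≠ 0)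
    (hu : IsMeromorphicSolution b c K s₁ s₂ s₃ u) (hac : a ^ 2 = c ^ 2)
    (hx : HasLead u x (-2) a) (hy : HasLead u y (-2) a) (z : ℂ) (hz : ¬ IsPoleAt u z) :
    u (z + (y - x)) = u z := by
  set p := y - x with hp
  have hy' : HasLead (fun z => u (z + p)) x (-2) a := by
    apply HasLead.comp_add_const
    simpa [hp] using hy
  have ha : a ≠ 0 := by
    rintro rfl
    exact hc (by simpa using hac.symm)
  have hshift (z : ℂ) : AnalyticAt ℂ (fun z => u (z + p)) z ↔ AnalyticAt ℂ u (z + p) := by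
    refine ⟨fun h => ?_, fun h => h.comp_of_eq (by fun_prop) rfl⟩
    have h' : AnalyticAt ℂ ((fun z => u (z + p)) ∘ fun z => z - p) (z + p) :=
      h.comp_of_eq (by fun_prop) (by ring)
    simpa [Function.comp_def] using h'
  have hva : ∀ᶠ z in 𝓝[≠] x, AnalyticAt ℂ (fun z => u (z + p)) z :=
    hy'.meromorphicAt.eventually_analyticAt
  have hloc := eventuallyEq_of_satisfiesE hc ha hac hx hy' hx.meromorphicAt.eventually_analyticAt
    hva (hx.meromorphicAt.eventually_analyticAt.mono hu.2)
    (hva.mono fun z hz => (hu.2 _ ((hshift z).1 hz)).comp_add_const)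
  have hcount : ({z | ¬ AnalyticAt ℂ u z} ∪ {z | ¬ AnalyticAt ℂ u (z + p)}).Countable :=
    hu.1.countable_poles.union
      (hu.1.countable_poles.preimage (f := fun z => z + p) (add_left_injective p))
  have hconn := (hcount.isConnected_compl_of_one_lt_rank
    (by rw [Complex.rank_real_complex]; norm_num)).isPreconnected
  set U := ({z | ¬ AnalyticAt ℂ u z} ∪ {z | ¬ AnalyticAt ℂ u (z + p)})ᶜ with hU
  have hUmem {z : ℂ} : z ∈ U ↔ AnalyticAt ℂ u z ∧ AnalyticAt ℂ u (z + p) := by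
    simp [hU]
  obtain ⟨w, hw, hwloc⟩ : ∃ w ∈ U, u =ᶠ[𝓝 w] fun z => u (z + p) := by
    have h1 : ∀ᶠ z in 𝓝[≠] x, u =ᶠ[𝓝 z] fun z => u (z + p) :=
      (eventually_eventually_nhdsWithin (s := {x}ᶜ)).2 hloc |>.and self_mem_nhdsWithin |>.mono
        fun z hz => by rw [EventuallyEq, ← isOpen_compl_singleton.nhdsWithin_eq hz.2]; exact hz.1
    obtain ⟨w, h1, h2, h3⟩ := (h1.and (hx.meromorphicAt.eventually_analyticAt.and hva)).exists
    exact ⟨w, hUmem.2 ⟨h2, (hshift w).1 h3⟩, h1⟩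
  have heq : Set.EqOn u (fun z => u (z + p)) U :=
    AnalyticOnNhd.eqOn_of_preconnected_of_eventuallyEq (fun z hz => (hUmem.1 hz).1)
      (fun z hz => (hshift z).2 (hUmem.1 hz).2) hconn hw hwloc
  have hza : AnalyticAt ℂ u z := (hu.1 z).resolve_right hz
  by_cases hzp : AnalyticAt ℂ u (z + p)
  · exact (heq (hUmem.2 ⟨hza, hzp⟩)).symm
  · exfalso
    have hm : MeromorphicAt (fun z => u (z + p)) z :=
      (hu.1.meromorphicAt (z + p)).comp_analyticAt (g := fun z => z + p) (by fun_prop)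
    have hev : ∀ᶠ t in 𝓝[≠] z, ‖u (t + p)‖ = ‖u t‖ := by
      filter_upwards [hm.eventually_analyticAt, hza.meromorphicAt.eventually_analyticAt]
        with t h1 h2
      rw [heq (hUmem.2 ⟨h2, (hshift t).1 h1⟩)]
    have ht : Tendsto (fun z => z + p) (𝓝[≠] z) (𝓝[≠] (z + p)) := by
      refine tendsto_nhdsWithin_of_tendsto_nhds_of_eventually_within _ ?_ ?_
      · exact (Continuous.tendsto (by fun_prop) z).mono_left nhdsWithin_le_nhds
      · filter_upwards [self_mem_nhdsWithin] with t ht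
        simpa using ht
    have := ((hu.1 _).resolve_left hzp).comp ht
    exact hz ((tendsto_congr' hev).1 this)

/-- Scale-invariant interior estimate: a solution holomorphic on a unit disc is bounded at the
centre by a constant depending only on the parameters. The proof chooses a point where
`‖u z‖ * dist(z, boundary) ^ 2` is maximal and applies the Cauchy estimates there. -/
lemma exists_bound_of_satisfiesE (b c K s₁ s₂ s₃ : ℂ) (hc : c ≠ 0) :
    ∃ M : ℝ, ∀ (u : ℂ → ℂ) (x : ℂ), (∀ z ∈ Metric.closedBall x 1, AnalyticAt ℂ u z) →
      (∀ z ∈ Metric.closedBall x 1, SatisfiesE b c K s₁ s₂ s₃ u z) → ‖u x‖ ≤ M := by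
  set κ : ℝ := ‖30 / c ^ 2‖ with hκ
  set S : ℂ := 3*s₁^4 - 6*s₁^2*s₂ + 4*s₁*s₃ with hS
  have hκ0 : 0 < κ := norm_pos_iff.2 (div_ne_zero (by norm_num) (pow_ne_zero 2 hc))
  set C : ℝ := 1536 + 512 + 1920 * ‖b‖ + κ * (4 * ‖s₁‖ + 6 * ‖s₂‖ + 4 * ‖s₃‖ + ‖S‖) + ‖K‖ with hC
  refine ⟨max 1 (C / κ), fun u x ha hE => ?_⟩
  by_contra! hlt
  obtain ⟨hB1, hBC⟩ := max_lt_iff.1 hlt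
  set B := ‖u x‖ with hB
  have hcont : ContinuousOn (fun z => ‖u z‖ * (1 - ‖z - x‖) ^ 2) (Metric.closedBall x 1) :=
    (ContinuousOn.norm fun z hz => (ha z hz).continuousAt.continuousWithinAt).mul
      (by fun_prop)
  obtain ⟨y, hy, hmax⟩ := (isCompact_closedBall x 1).exists_isMaxOn
    ⟨x, Metric.mem_closedBall_self zero_le_one⟩ hcont
  have hmax' (z) (hz : z ∈ Metric.closedBall x 1) :
      ‖u z‖ * (1 - ‖z - x‖) ^ 2 ≤ ‖u y‖ * (1 - ‖y - x‖) ^ 2 := hmax hz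
  set A := ‖u y‖ with hA
  set d := 1 - ‖y - x‖ with hd
  have hBA : B ≤ A * d ^ 2 := by
    simpa using hmax' x (Metric.mem_closedBall_self zero_le_one)
  have hd0 : 0 ≤ d := by
    have := mem_closedBall_iff_norm.1 hy
    linarith
  have hd1 : d ≤ 1 := by linarith [norm_nonneg (y - x)]
  have hdpos : 0 < d := by
    rcases hd0.lt_or_eq with h | h
    · exact h
    · rw [← h] at hBA; norm_num at hBA; linarith
  have hA0 : 0 ≤ A := norm_nonneg _
  have hAB : B ≤ A := hBA.trans (mul_le_of_le_one_right hA0 (pow_le_one₀ hd0 hd1))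
  have hsub : Metric.closedBall y (d / 2) ⊆ Metric.closedBall x 1 := by
    intro z hz
    rw [mem_closedBall_iff_norm] at hz ⊢
    have := norm_sub_le_norm_sub_add_norm_sub z y x
    linarith
  have hdiff : DiffContOnCl ℂ u (Metric.ball y (d / 2)) := by
    refine DifferentiableOn.diffContOnCl fun z hz => ?_
    exact (ha z (hsub (Metric.closure_ball_subset_closedBall hz))).differentiableAt
      |>.differentiableWithinAt
  have hsph (z) (hz : z ∈ Metric.sphere y (d / 2)) : ‖u z‖ ≤ 4 * A := by
    have h1 := hmax' z (hsub (Metric.sphere_subset_closedBall hz))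
    have h2 := norm_sub_le_norm_sub_add_norm_sub z y x
    rw [mem_sphere_iff_norm] at hz
    have h3 : (d / 2) ^ 2 ≤ (1 - ‖z - x‖) ^ 2 := pow_le_pow_left₀ (by positivity) (by linarith) 2
    have h4 : ‖u z‖ * (d / 2) ^ 2 ≤ A * d ^ 2 :=
      (mul_le_mul_of_nonneg_left h3 (norm_nonneg _)).trans h1
    have h5 : 0 < d ^ 2 := by positivity
    nlinarith
  have cauchy (n : ℕ) := norm_iteratedDeriv_le_of_forall_mem_sphere_norm_le n (half_pos hdpos)
    hdiff hsph
  set X : ℝ := 1 / (d / 2) ^ 2 with hX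
  have hX0 : 0 < X := by positivity
  have hXA : X ≤ 4 * (A / B) := by
    rw [hX, div_le_iff₀ (by positivity)]
    have : 1 ≤ A * d ^ 2 / B := (one_le_div (by linarith)).2 hBA
    calc 1 ≤ A * d ^ 2 / B := this
      _ = _ := by ring
  have h1 := cauchy 1
  have h2 := cauchy 2
  have h3 := cauchy 3
  rw [iteratedDeriv_one] at h1
  have e := hE y hy
  have hB0 : 0 < B := by linarith
  have hR1 : 1 ≤ A / B := (one_le_div hB0).2 hAB
  have hA1 : 1 ≤ A := by linarith
  have hRA : A / B ≤ A := div_le_self hA0 hB1.le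
  have p13 : ‖deriv u y * iteratedDeriv 3 u y‖ ≤ 1536 * A ^ 3 * (A / B) := by
    rw [norm_mul]
    calc _ ≤ (Nat.factorial 1 * (4 * A) / (d / 2) ^ 1) *
          (Nat.factorial 3 * (4 * A) / (d / 2) ^ 3) := by gcongr
      _ = 96 * A ^ 2 * X ^ 2 := by
        simp only [hX, Nat.factorial]; push_cast; field_simp; ring
      _ ≤ 96 * A ^ 2 * (4 * (A / B)) ^ 2 := by gcongr
      _ = 1536 * A ^ 2 * (A / B) * (A / B) := by ring
      _ ≤ 1536 * A ^ 2 * (A / B) * A := by gcongr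
      _ = _ := by ring
  have p22 : ‖(1/2) * iteratedDeriv 2 u y ^ 2‖ ≤ 512 * A ^ 3 * (A / B) := by
    rw [norm_mul, norm_pow, show ‖(1 / 2 : ℂ)‖ = 1 / 2 by simp]
    calc _ ≤ 1 / 2 * (Nat.factorial 2 * (4 * A) / (d / 2) ^ 2) ^ 2 := by gcongr
      _ = 32 * A ^ 2 * X ^ 2 := by
        simp only [hX, Nat.factorial]; push_cast; field_simp; ring
      _ ≤ 32 * A ^ 2 * (4 * (A / B)) ^ 2 := by gcongr
      _ = 512 * A ^ 2 * (A / B) * (A / B) := by ring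
      _ ≤ 512 * A ^ 2 * (A / B) * A := by gcongr
      _ = _ := by ring
  have p11 : ‖30 * b * deriv u y ^ 2‖ ≤ 1920 * ‖b‖ * A ^ 3 * (A / B) := by
    rw [norm_mul, norm_mul, norm_pow, show ‖(30 : ℂ)‖ = 30 by simp]
    calc _ ≤ 30 * ‖b‖ * (Nat.factorial 1 * (4 * A) / (d / 2) ^ 1) ^ 2 := by gcongr
      _ = 480 * ‖b‖ * A ^ 2 * X := by
        simp only [hX, Nat.factorial]; push_cast; field_simp; ring
      _ ≤ 480 * ‖b‖ * A ^ 2 * (4 * (A / B)) := by gcongr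
      _ = 1920 * ‖b‖ * A ^ 2 * (A / B) := by ring
      _ ≤ 1920 * ‖b‖ * A ^ 3 * (A / B) := by gcongr; norm_num
  have pl : ‖-(4*s₁*(u y)^3) + 6*s₂*(u y)^2 - 4*s₃*(u y) + S‖ ≤
      (4 * ‖s₁‖ + 6 * ‖s₂‖ + 4 * ‖s₃‖ + ‖S‖) * A ^ 3 * (A / B) := by
    have hA3 : A ^ 3 ≤ A ^ 3 * (A / B) := le_mul_of_one_le_right (by positivity) hR1
    have hA2 : A ^ 2 ≤ A ^ 3 := pow_le_pow_right₀ hA1 (by norm_num)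
    have hA1' : A ≤ A ^ 3 := le_self_pow₀ hA1 (by norm_num)
    calc _ ≤ ‖4*s₁*(u y)^3‖ + ‖6*s₂*(u y)^2‖ + ‖4*s₃*(u y)‖ + ‖S‖ := by
          refine (norm_add_le _ _).trans (add_le_add_left ?_ _)
          refine (norm_sub_le _ _).trans (add_le_add_left ?_ _)
          refine (norm_add_le _ _).trans (add_le_add_left ?_ _)
          rw [norm_neg]
      _ = 4 * ‖s₁‖ * A ^ 3 + 6 * ‖s₂‖ * A ^ 2 + 4 * ‖s₃‖ * A + ‖S‖ * 1 := by
          simp [hA]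
      _ ≤ 4 * ‖s₁‖ * A ^ 3 + 6 * ‖s₂‖ * A ^ 3 + 4 * ‖s₃‖ * A ^ 3 + ‖S‖ * A ^ 3 := by
          gcongr
          exact one_le_pow₀ hA1
      _ = (4 * ‖s₁‖ + 6 * ‖s₂‖ + 4 * ‖s₃‖ + ‖S‖) * A ^ 3 := by ring
      _ ≤ (4 * ‖s₁‖ + 6 * ‖s₂‖ + 4 * ‖s₃‖ + ‖S‖) * (A ^ 3 * (A / B)) := by gcongr
      _ = _ := by ring
  have pK : ‖K‖ ≤ ‖K‖ * A ^ 3 * (A / B) := by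
    rw [mul_assoc]
    exact le_mul_of_one_le_right (norm_nonneg _) (one_le_mul_of_one_le_of_one_le
      (one_le_pow₀ hA1) hR1)
  have e4 : (30 / c ^ 2) * (u y) ^ 4 = deriv u y * iteratedDeriv 3 u y
      - (1/2) * iteratedDeriv 2 u y ^ 2 + 30 * b * deriv u y ^ 2
      - (30 / c ^ 2) * (-(4*s₁*(u y)^3) + 6*s₂*(u y)^2 - 4*s₃*(u y) + S) - K := by
    rw [SatisfiesE] at e
    linear_combination -e
  have h4 : κ * A ^ 4 ≤ C * A ^ 3 * (A / B) := by
    calc κ * A ^ 4 = ‖(30 / c ^ 2) * (u y) ^ 4‖ := by rw [norm_mul, norm_pow]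
      _ ≤ ‖deriv u y * iteratedDeriv 3 u y‖ + ‖(1/2) * iteratedDeriv 2 u y ^ 2‖
          + ‖30 * b * deriv u y ^ 2‖
          + κ * ‖-(4*s₁*(u y)^3) + 6*s₂*(u y)^2 - 4*s₃*(u y) + S‖ + ‖K‖ := by
        rw [e4, hκ, ← norm_mul]
        refine (norm_sub_le _ _).trans (add_le_add_left ?_ _)
        refine (norm_sub_le _ _).trans (add_le_add_left ?_ _)
        refine (norm_add_le _ _).trans (add_le_add_left ?_ _)
        exact norm_sub_le _ _
      _ ≤ 1536 * A ^ 3 * (A / B) + 512 * A ^ 3 * (A / B) + 1920 * ‖b‖ * A ^ 3 * (A / B)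
          + κ * ((4 * ‖s₁‖ + 6 * ‖s₂‖ + 4 * ‖s₃‖ + ‖S‖) * A ^ 3 * (A / B))
          + ‖K‖ * A ^ 3 * (A / B) := by gcongr
      _ = _ := by rw [hC]; ring
  have h5 : C * A ^ 3 * (A / B) = C / B * A ^ 4 := by ring
  rw [h5] at h4
  have h6 : κ ≤ C / B := le_of_mul_le_mul_right h4 (by positivity)
  rw [le_div_iff₀ hB0] at h6
  rw [div_lt_iff₀ hκ0] at hBC
  linarith

/-- An entire function of polynomial growth is a polynomial. -/
lemma Differentiable.exists_polynomial {f : ℂ → ℂ} (hf : Differentiable ℂ f) {C R₀ : ℝ} {N : ℕ}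
    (hb : ∀ z, R₀ ≤ ‖z‖ → ‖f z‖ ≤ C * ‖z‖ ^ N) : ∃ p : Polynomial ℂ, ∀ z, f z = p.eval z := by
  have hzero (n : ℕ) (hn : N < n) : iteratedDeriv n f 0 = 0 := by
    have h1 : ∀ᶠ R : ℝ in atTop, ‖iteratedDeriv n f 0‖ ≤ n.factorial * C * R⁻¹ := by
      filter_upwards [eventually_ge_atTop R₀, eventually_ge_atTop 1] with R hR hR1
      have hR0 : 0 < R := by linarith
      have hC : 0 ≤ C := by
        have := (norm_nonneg _).trans (hb (R : ℂ) (by simpa [abs_of_pos hR0] using hR))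
        exact nonneg_of_mul_nonneg_left this (by simp; positivity)
      calc _ ≤ n.factorial * (C * R ^ N) / R ^ n :=
            norm_iteratedDeriv_le_of_forall_mem_sphere_norm_le n hR0 hf.diffContOnCl
              fun z hz => by
                have hz : ‖z‖ = R := by simpa using hz
                simpa [hz] using hb z (hz ▸ hR)
        _ = n.factorial * C * (R ^ N / R ^ n) := by ring
        _ ≤ n.factorial * C * R⁻¹ := by
            gcongr
            rw [div_le_iff₀ (by positivity), ← div_eq_inv_mul, le_div_iff₀ hR0, ← pow_succ]
            exact pow_le_pow_right₀ hR1 hn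
    have h2 : Tendsto (fun R : ℝ => n.factorial * C * R⁻¹) atTop (𝓝 0) := by
      simpa using tendsto_inv_atTop_zero.const_mul (n.factorial * C)
    exact norm_le_zero_iff.1 (ge_of_tendsto h2 h1)
  refine ⟨∑ n ∈ Finset.range (N + 1),
    Polynomial.monomial n ((n.factorial : ℂ)⁻¹ * iteratedDeriv n f 0), fun z => ?_⟩
  rw [← taylorSeries_eq_of_entire' 0 z hf, tsum_eq_sum (s := Finset.range (N + 1)),
    Polynomial.eval_finsetSum]
  · simp
  · intro n hn
    rw [hzero n (by simpa using hn)]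
    simp

/-- Polynomials have polynomial growth. -/
lemma Polynomial.exists_norm_eval_le (q : Polynomial ℂ) :
    ∃ C : ℝ, ∀ z : ℂ, 1 ≤ ‖z‖ → ‖q.eval z‖ ≤ C * ‖z‖ ^ q.natDegree := by
  refine ⟨∑ i ∈ Finset.range (q.natDegree + 1), ‖q.coeff i‖, fun z hz => ?_⟩
  rw [Polynomial.eval_eq_sum_range, Finset.sum_mul]
  refine norm_sum_le_of_le _ fun i hi => ?_
  rw [norm_mul, norm_pow]
  gcongr
  exact Nat.lt_succ_iff.1 (Finset.mem_range.1 hi)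

/-- A solution with finitely many poles is rational. -/
lemma isRationalFunction_of_finite_poles {b c K s₁ s₂ s₃ : ℂ} {u : ℂ → ℂ} (hc : c ≠ 0)
    (hu : IsMeromorphicSolution b c K s₁ s₂ s₃ u) (hfin : {z | ¬ AnalyticAt ℂ u z}.Finite) :
    IsRationalFunction u := by
  obtain ⟨M, hM⟩ := exists_bound_of_satisfiesE b c K s₁ s₂ s₃ hc
  set q : Polynomial ℂ := ∏ s ∈ hfin.toFinset, (Polynomial.X - Polynomial.C s) ^ 2 with hq
  have hq0 : q ≠ 0 :=
    Finset.prod_ne_zero_iff.2 fun s _ => pow_ne_zero 2 (Polynomial.X_sub_C_ne_zero s)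
  have hqan (z : ℂ) : AnalyticAt ℂ (fun z => q.eval z) z :=
    (Polynomial.differentiable q).analyticAt z
  set F : ℂ → ℂ := fun z => q.eval z * u z with hF
  have hFm : MeromorphicOn F Set.univ := fun z _ =>
    (hqan z).meromorphicAt.mul (hu.1.meromorphicAt z)
  have hFan {z : ℂ} (hz : AnalyticAt ℂ u z) : AnalyticAt ℂ F z := (hqan z).mul hz
  have hord (z : ℂ) : 0 ≤ meromorphicOrderAt F z := by
    by_cases hz : AnalyticAt ℂ u z
    · exact (hFan hz).meromorphicOrderAt_nonneg
    · obtain ⟨a, -, f, hf, -, he⟩ := ((hu.1 z).resolve_left hz).exists_hasLead hc hu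
      obtain ⟨r, hr⟩ : (Polynomial.X - Polynomial.C z) ^ 2 ∣ q :=
        Finset.dvd_prod_of_mem _ (by simpa using hz)
      have hFe : F =ᶠ[𝓝[≠] z] fun y => r.eval y * f y := by
        filter_upwards [he, self_mem_nhdsWithin] with y hy hyz
        have hyz : y - z ≠ 0 := sub_ne_zero.2 hyz
        simp only [hF, hy, hr, Polynomial.eval_mul, Polynomial.eval_pow, Polynomial.eval_sub,
          Polynomial.eval_X, Polynomial.eval_C, zpow_neg]
        norm_cast
        field_simp
      rw [meromorphicOrderAt_congr hFe]
      exact (((Polynomial.differentiable r).analyticAt z).mul hf).meromorphicOrderAt_nonneg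
  set H := toMeromorphicNFOn F Set.univ with hH
  have hHan (z : ℂ) : AnalyticAt ℂ H z := by
    have hnf : MeromorphicNFAt H z := meromorphicNFOn_toMeromorphicNFOn F Set.univ (Set.mem_univ z)
    rw [← hnf.meromorphicOrderAt_nonneg_iff_analyticAt, hH,
      meromorphicOrderAt_toMeromorphicNFOn hFm (Set.mem_univ z)]
    exact hord z
  have hHF {z : ℂ} (hz : AnalyticAt ℂ u z) : H z = F z :=
    (((hHan z).meromorphicNFAt.eventuallyEq_nhdsNE_iff_eventuallyEq_nhds
      (hFan hz).meromorphicNFAt).1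
        (hFm.toMeromorphicNFOn_eq_self_on_nhdsNE (Set.mem_univ z))).eq_of_nhds
  obtain ⟨R, hR⟩ := hfin.isBounded.subset_closedBall 0
  obtain ⟨C, hC⟩ := q.exists_norm_eval_le
  obtain ⟨p, hp⟩ := Differentiable.exists_polynomial (f := H) (C := C * M) (R₀ := max 1 (R + 2))
    (N := q.natDegree) (fun z => (hHan z).differentiableAt) (fun z hz => by
      obtain ⟨hz1, hz2⟩ := max_le_iff.1 hz
      have han (y) (hy : y ∈ Metric.closedBall z 1) : AnalyticAt ℂ u y := by
        by_contra hy'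
        have h1 : ‖y‖ ≤ R := by simpa using hR hy'
        have h2 : ‖z - y‖ ≤ 1 := by simpa [dist_eq_norm, norm_sub_rev] using hy
        have h3 := norm_sub_norm_le z y
        linarith
      have hMz := hM u z han fun y hy => hu.2 y (han y hy)
      have hCz := hC z hz1
      rw [hHF (han z (Metric.mem_closedBall_self zero_le_one)), hF, norm_mul]
      calc _ ≤ (C * ‖z‖ ^ q.natDegree) * M :=
            mul_le_mul hCz hMz (norm_nonneg _) ((norm_nonneg _).trans hCz)
        _ = _ := by ring)
  refine ⟨p, q, hq0, fun z hz hqz => ?_⟩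
  rw [eq_div_iff hqz, ← hp, hHF hz, hF, mul_comm]

/-- A transcendental (non-rational) meromorphic solution of (E) is periodic. -/
theorem transcendental_solution_is_periodic
    (b c K s₁ s₂ s₃ : ℂ) (hc : c ≠ 0)
    (u : ℂ → ℂ) (hu : IsMeromorphicSolution b c K s₁ s₂ s₃ u)
    (htrans : ¬ IsRationalFunction u) :
    ∃ p : ℂ, p ≠ 0 ∧ ∀ z : ℂ, ¬ IsPoleAt u z → u (z + p) = u z := by
  have hinf : {z | ¬ AnalyticAt ℂ u z}.Infinite := fun h =>
    htrans (isRationalFunction_of_finite_poles hc hu h)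
  have hlead (z : {z | ¬ AnalyticAt ℂ u z}) :
      ∃ a : ℂ, a ∈ ({c, -c} : Set ℂ) ∧ a ^ 2 = c ^ 2 ∧ HasLead u z (-2) a := by
    obtain ⟨a, h1, h2⟩ := ((hu.1 z).resolve_left z.2).exists_hasLead hc hu
    exact ⟨a, sq_eq_sq_iff_eq_or_eq_neg.1 h1, h1, h2⟩
  choose a hmem hsq hl using hlead
  have := hinf.to_subtype
  obtain ⟨x, y, hxy, he⟩ := Finite.exists_ne_map_eq_of_infinite
    fun z : {z | ¬ AnalyticAt ℂ u z} => (⟨a z, hmem z⟩ : ({c, -c} : Set ℂ))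
  have he : a x = a y := congrArg Subtype.val he
  exact ⟨y - x, sub_ne_zero.2 fun h => hxy (Subtype.ext h.symm),
    periodic_of_hasLead hc hu (hsq x) (hl x) (he ▸ hl y)⟩

end
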